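/- Proposition 2 (3-1 split suffices for simultaneous decoding): 𝓡₁,SD(p) ∩ 𝓡₂,SD(p) equals the union, over all three-layer split distributions p' ≃ p and over the two decoding-order pairs (d₁,d₂), of the regions 𝓡_SWSC(p',3,1,d₁,d₂), where for the first pair the region is {(R₁,R₂): R₁ ≤ min{I(X₁;Y₁)+I(X₂,X₃;Y₁|X₁,W), I(X₁,X₂;Y₂)+I(X₃;Y₂|X₁,X₂,W)}, R₂ ≤ min{I(W;Y₁|X₁), I(W;Y₂|X₁,X₂)}} and for the second pair it is {(R₁,R₂): R₁ ≤ min{I(X₁,X₂;Y₁)+I(X₃;Y₁|X₁,X₂,W), I(X₁;Y₂)+I(X₂,X₃;Y₂|X₁,W)}, R₂ ≤ min{I(W;Y₂|X₁), I(W;Y₁|X₁,X₂)}}. -/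

import Mathlib

open scoped BigOperators Classical

noncomputable section

/-- Pushforward of a finitely supported weight function along a map. -/
def pushf {Ω β : Type*} [Fintype Ω] (q : Ω → ℝ) (f : Ω → β) : β → ℝ :=
  fun b => ∑ ω, if f ω = b then q ω else 0

/-- Shannon entropy (in nats). -/
def ent {β : Type*} [Fintype β] (p : β → ℝ) : ℝ :=
  -∑ b, p b * Real.log (p b)

/-- Entropy of the random variable `A` under the joint pmf `q`. -/
def Hof {Ω β : Type*} [Fintype Ω] [Fintype β] (q : Ω → ℝ) (A : Ω → β) : ℝ :=
  ent (pushf q A)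

/-- Mutual information `I(A;B)` under the joint pmf `q`. -/
def miOf {Ω α β : Type*} [Fintype Ω] [Fintype α] [Fintype β]
    (q : Ω → ℝ) (A : Ω → α) (B : Ω → β) : ℝ :=
  Hof q A + Hof q B - Hof q (fun ω => (A ω, B ω))

/-- Conditional mutual information `I(A;B|C)` under the joint pmf `q`. -/
def cmiOf {Ω α β γ : Type*} [Fintype Ω] [Fintype α] [Fintype β] [Fintype γ]
    (q : Ω → ℝ) (A : Ω → α) (B : Ω → β) (C : Ω → γ) : ℝ :=
  Hof q (fun ω => (A ω, C ω)) + Hof q (fun ω => (B ω, C ω))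
    - Hof q (fun ω => (A ω, B ω, C ω)) - Hof q C

/-- `p` is a probability mass function. -/
def IsPMF {α : Type*} [Fintype α] (p : α → ℝ) : Prop :=
  (∀ a, 0 ≤ p a) ∧ ∑ a, p a = 1

/-- Joint pmf on `(X, W, Y₁, Y₂)` induced by the product input pmf `pX · pW`
and the interference channel `ch`. -/
def icJoint {𝒳 𝒲 𝒴₁ 𝒴₂ : Type} (pX : 𝒳 → ℝ) (pW : 𝒲 → ℝ)
    (ch : 𝒳 → 𝒲 → 𝒴₁ → 𝒴₂ → ℝ) : 𝒳 × 𝒲 × 𝒴₁ × 𝒴₂ → ℝ :=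
  fun ω => pX ω.1 * pW ω.2.1 * ch ω.1 ω.2.1 ω.2.2.1 ω.2.2.2

variable {𝒳 𝒲 𝒴₁ 𝒴₂ : Type} [Fintype 𝒳] [Fintype 𝒲] [Fintype 𝒴₁] [Fintype 𝒴₂]

/-- `𝓡₁,SD(p)`: `R₁ ≤ I(X;Y₁|W)`, `R₂ ≤ I(W;Y₁|X)`, `R₁+R₂ ≤ I(X,W;Y₁)`. -/
def R1SD (pX : 𝒳 → ℝ) (pW : 𝒲 → ℝ) (ch : 𝒳 → 𝒲 → 𝒴₁ → 𝒴₂ → ℝ) : Set (ℝ × ℝ) :=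
  {R | 0 ≤ R.1 ∧ 0 ≤ R.2 ∧
    R.1 ≤ cmiOf (icJoint pX pW ch) (fun ω => ω.1) (fun ω => ω.2.2.1) (fun ω => ω.2.1) ∧
    R.2 ≤ cmiOf (icJoint pX pW ch) (fun ω => ω.2.1) (fun ω => ω.2.2.1) (fun ω => ω.1) ∧
    R.1 + R.2 ≤ miOf (icJoint pX pW ch) (fun ω => (ω.1, ω.2.1)) (fun ω => ω.2.2.1)}

/-- `𝓡₂,SD(p)`: `R₂ ≤ I(W;Y₂|X)`, `R₁ ≤ I(X;Y₂|W)`, `R₁+R₂ ≤ I(X,W;Y₂)`. -/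
def R2SD (pX : 𝒳 → ℝ) (pW : 𝒲 → ℝ) (ch : 𝒳 → 𝒲 → 𝒴₁ → 𝒴₂ → ℝ) : Set (ℝ × ℝ) :=
  {R | 0 ≤ R.1 ∧ 0 ≤ R.2 ∧
    R.1 ≤ cmiOf (icJoint pX pW ch) (fun ω => ω.1) (fun ω => ω.2.2.2) (fun ω => ω.2.1) ∧
    R.2 ≤ cmiOf (icJoint pX pW ch) (fun ω => ω.2.1) (fun ω => ω.2.2.2) (fun ω => ω.1) ∧
    R.1 + R.2 ≤ miOf (icJoint pX pW ch) (fun ω => (ω.1, ω.2.1)) (fun ω => ω.2.2.2)}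

/-- A three-layer split distribution `p'` for sender 1, together with sender 2's pmf:
independent `X₁ ~ p1`, `X₂ ~ p2`, `X₃ ~ p3`, `W ~ pw` and a symbol-by-symbol map `f`. -/
structure SplitDist3 (𝒳 𝒲 : Type) [Fintype 𝒳] [Fintype 𝒲] where
  A1 : Type
  A2 : Type
  A3 : Type
  [fin1 : Fintype A1]
  [fin2 : Fintype A2]
  [fin3 : Fintype A3]
  p1 : A1 → ℝ
  p2 : A2 → ℝ
  p3 : A3 → ℝ
  pw : 𝒲 → ℝ
  f : A1 → A2 → A3 → 𝒳
  p1_pmf : IsPMF p1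
  p2_pmf : IsPMF p2
  p3_pmf : IsPMF p3
  pw_pmf : IsPMF pw

attribute [instance] SplitDist3.fin1 SplitDist3.fin2 SplitDist3.fin3

/-- `p' ≃ p` : the split induces `X = f(X₁,X₂,X₃) ~ pX` and `W ~ pW`. -/
def SplitDist3.Matches {𝒳 𝒲 : Type} [Fintype 𝒳] [Fintype 𝒲]
    (s : SplitDist3 𝒳 𝒲) (pX : 𝒳 → ℝ) (pW : 𝒲 → ℝ) : Prop :=
  (∀ x, pushf (fun a : s.A1 × s.A2 × s.A3 => s.p1 a.1 * s.p2 a.2.1 * s.p3 a.2.2)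
      (fun a => s.f a.1 a.2.1 a.2.2) x = pX x) ∧ s.pw = pW

/-- Joint pmf on `(X₁, X₂, X₃, W, Y₁, Y₂)` induced by a 3-layer split and the channel. -/
def swJoint3 {𝒳 𝒲 𝒴₁ 𝒴₂ : Type} [Fintype 𝒳] [Fintype 𝒲] (s : SplitDist3 𝒳 𝒲)
    (ch : 𝒳 → 𝒲 → 𝒴₁ → 𝒴₂ → ℝ) : s.A1 × s.A2 × s.A3 × 𝒲 × 𝒴₁ × 𝒴₂ → ℝ :=
  fun ω => s.p1 ω.1 * s.p2 ω.2.1 * s.p3 ω.2.2.1 * s.pw ω.2.2.2.1 *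
    ch (s.f ω.1 ω.2.1 ω.2.2.1) ω.2.2.2.1 ω.2.2.2.2.1 ω.2.2.2.2.2

variable {𝒳 𝒲 𝒴₁ 𝒴₂ : Type} [Fintype 𝒳] [Fintype 𝒲] [Fintype 𝒴₁] [Fintype 𝒴₂]

/-- `𝓡_SWSC(p',3,1,d₁,d₂)` for the decoding orders
`d₁: m̂₁(j−2) → m̂₂(j)`, `d₂: m̂₁(j−2) → m̂₂(j−1)`. -/
def RSWSC31A (s : SplitDist3 𝒳 𝒲) (ch : 𝒳 → 𝒲 → 𝒴₁ → 𝒴₂ → ℝ) : Set (ℝ × ℝ) :=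
  {R | 0 ≤ R.1 ∧ 0 ≤ R.2 ∧
    R.1 ≤ min
      (miOf (swJoint3 s ch) (fun ω => ω.1) (fun ω => ω.2.2.2.2.1)
        + cmiOf (swJoint3 s ch) (fun ω => (ω.2.1, ω.2.2.1)) (fun ω => ω.2.2.2.2.1)
            (fun ω => (ω.1, ω.2.2.2.1)))
      (miOf (swJoint3 s ch) (fun ω => (ω.1, ω.2.1)) (fun ω => ω.2.2.2.2.2)
        + cmiOf (swJoint3 s ch) (fun ω => ω.2.2.1) (fun ω => ω.2.2.2.2.2)
            (fun ω => (ω.1, ω.2.1, ω.2.2.2.1))) ∧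
    R.2 ≤ min
      (cmiOf (swJoint3 s ch) (fun ω => ω.2.2.2.1) (fun ω => ω.2.2.2.2.1) (fun ω => ω.1))
      (cmiOf (swJoint3 s ch) (fun ω => ω.2.2.2.1) (fun ω => ω.2.2.2.2.2)
        (fun ω => (ω.1, ω.2.1)))}

/-- `𝓡_SWSC(p',3,1,d₁',d₂')` for the swapped decoding orders
`d₁': m̂₁(j−2) → m̂₂(j−1)`, `d₂': m̂₁(j−2) → m̂₂(j)`. -/
def RSWSC31B (s : SplitDist3 𝒳 𝒲) (ch : 𝒳 → 𝒲 → 𝒴₁ → 𝒴₂ → ℝ) : Set (ℝ × ℝ) :=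
  {R | 0 ≤ R.1 ∧ 0 ≤ R.2 ∧
    R.1 ≤ min
      (miOf (swJoint3 s ch) (fun ω => (ω.1, ω.2.1)) (fun ω => ω.2.2.2.2.1)
        + cmiOf (swJoint3 s ch) (fun ω => ω.2.2.1) (fun ω => ω.2.2.2.2.1)
            (fun ω => (ω.1, ω.2.1, ω.2.2.2.1)))
      (miOf (swJoint3 s ch) (fun ω => ω.1) (fun ω => ω.2.2.2.2.2)
        + cmiOf (swJoint3 s ch) (fun ω => (ω.2.1, ω.2.2.1)) (fun ω => ω.2.2.2.2.2)
            (fun ω => (ω.1, ω.2.2.2.1))) ∧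
    R.2 ≤ min
      (cmiOf (swJoint3 s ch) (fun ω => ω.2.2.2.1) (fun ω => ω.2.2.2.2.2) (fun ω => ω.1))
      (cmiOf (swJoint3 s ch) (fun ω => ω.2.2.2.1) (fun ω => ω.2.2.2.2.1)
        (fun ω => (ω.1, ω.2.1)))}

section Entropy

variable {Ω α β γ ι : Type*} [Fintype Ω] [Fintype α] [Fintype β] [Fintype γ] [Fintype ι]

lemma ent_eq_sum_negMulLog (p : β → ℝ) : ent p = ∑ b, Real.negMulLog (p b) := by
  simp [ent, Real.negMulLog]

lemma sum_pushf_mul (q : Ω → ℝ) (A : Ω → β) (g : β → ℝ) :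
    ∑ b, pushf q A b * g b = ∑ ω, q ω * g (A ω) := by
  simp only [pushf, Finset.sum_mul, ite_mul, zero_mul]
  rw [Finset.sum_comm]
  simp

lemma sum_pushf (q : Ω → ℝ) (A : Ω → β) : ∑ b, pushf q A b = ∑ ω, q ω := by
  simpa using sum_pushf_mul q A fun _ => 1

omit [Fintype β] in
lemma pushf_nonneg {q : Ω → ℝ} (hq : ∀ ω, 0 ≤ q ω) (A : Ω → β) (b : β) : 0 ≤ pushf q A b :=
  Finset.sum_nonneg fun ω _ => by split_ifs <;> simp [hq]

lemma pushf_id (q : Ω → ℝ) : pushf q (fun ω => ω) = q := by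
  funext b
  simp [pushf]

lemma Hof_eq_sum (q : Ω → ℝ) (A : Ω → β) :
    Hof q A = -∑ ω, q ω * Real.log (pushf q A (A ω)) := by
  rw [Hof, ent, sum_pushf_mul q A fun b => Real.log (pushf q A b)]

/-- Entropy only depends on the partition generated by a random variable. -/
lemma Hof_congr (q : Ω → ℝ) {A : Ω → α} {B : Ω → β}
    (h : ∀ ω ω', A ω = A ω' ↔ B ω = B ω') : Hof q A = Hof q B := by
  simp only [Hof_eq_sum, pushf, h]

lemma cmiOf_congr_cond (q : Ω → ℝ) (A : Ω → α) (B : Ω → β) {C : Ω → γ} {D : Ω → ι}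
    (h : ∀ ω ω', C ω = C ω' ↔ D ω = D ω') : cmiOf q A B C = cmiOf q A B D := by
  unfold cmiOf
  congr 1
  · congr 1
    · congr 1 <;> exact Hof_congr q fun ω ω' => by simp [h]
    · exact Hof_congr q fun ω ω' => by simp [h]
  · exact Hof_congr q h

omit [Fintype α] [Fintype γ] in
lemma pushf_marginal (q : Ω → ℝ) {A : Ω → α} {B : Ω → β} {C : Ω → γ} (e : α → β → γ)
    (h : ∀ ω a b, C ω = e a b ↔ A ω = a ∧ B ω = b) (a : α) :
    pushf q A a = ∑ b, pushf q C (e a b) := by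
  simp only [pushf, h]
  rw [Finset.sum_comm]
  refine Finset.sum_congr rfl fun ω _ => ?_
  by_cases hA : A ω = a <;> simp [hA]

/-- Chain rule for entropy. -/
lemma ent_mul_kernel (P : ι → ℝ) (L : ι → β → ℝ) (hL : ∀ i, ∑ b, L i b = 1) :
    ent (fun z : ι × β => P z.1 * L z.1 z.2) = ent P + ∑ i, P i * ent (L i) := by
  simp only [ent_eq_sum_negMulLog, Fintype.sum_prod_type, Real.negMulLog_mul,
    Finset.sum_add_distrib, ← Finset.sum_mul, ← Finset.mul_sum, hL, one_mul]

/-- Log sum inequality. -/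
lemma log_sum_le {a b : ι → ℝ} (ha : ∀ i, 0 ≤ a i) (hb : ∀ i, 0 ≤ b i)
    (hab : ∀ i, b i = 0 → a i = 0) :
    (∑ i, a i) * Real.log ((∑ i, a i) / ∑ i, b i) ≤ ∑ i, a i * Real.log (a i / b i) := by
  set A := ∑ i, a i
  set B := ∑ i, b i
  rcases (Finset.sum_nonneg fun i _ => ha i : 0 ≤ A).eq_or_lt with hA | hA
  · have h0 : ∀ i, a i = 0 := fun i =>
      (Finset.sum_eq_zero_iff_of_nonneg fun i _ => ha i).1 hA.symm i (Finset.mem_univ i)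
    simp [A, h0]
  have hB : 0 < B := by
    obtain ⟨i, -, hi⟩ := Finset.exists_ne_zero_of_sum_ne_zero hA.ne'
    exact Finset.sum_pos' (fun i _ => hb i)
      ⟨i, Finset.mem_univ i, (hb i).lt_of_ne' (mt (hab i) hi)⟩
  have hterm : ∀ i, a i * Real.log (A / B) + a i - b i * (A / B) ≤ a i * Real.log (a i / b i) := by
    intro i
    rcases (ha i).eq_or_lt with h0 | ha'
    · have := mul_nonneg (hb i) (div_pos hA hB).le
      simp only [← h0, zero_mul, zero_add]
      linarith
    have hb' : 0 < b i := (hb i).lt_of_ne' (mt (hab i) ha'.ne')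
    have h := Real.one_sub_inv_le_log_of_pos (x := (a i / b i) / (A / B)) (by positivity)
    rw [Real.log_div (by positivity) (by positivity)] at h
    have h2 := mul_le_mul_of_nonneg_left h ha'.le
    have h3 : a i * (1 - ((a i / b i) / (A / B))⁻¹) = a i - b i * (A / B) := by
      field_simp
    linarith
  calc A * Real.log (A / B) = A * Real.log (A / B) + A - B * (A / B) := by field_simp; ring
    _ = ∑ i, (a i * Real.log (A / B) + a i - b i * (A / B)) := by
      simp only [Finset.sum_add_distrib, Finset.sum_sub_distrib, ← Finset.sum_mul, A, B]
    _ ≤ _ := Finset.sum_le_sum fun i _ => hterm i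

end Entropy

section MixedInput

variable {𝒳 𝒲 𝒴 ι : Type*} [Fintype 𝒳] [Fintype 𝒲] [Fintype 𝒴] [Fintype ι]

/-- The channel from `W` to `Y` obtained by averaging the input `X` over the weights `μ`. -/
def mixCh (K : 𝒳 → 𝒲 → 𝒴 → ℝ) (μ : 𝒳 → ℝ) (w : 𝒲) (y : 𝒴) : ℝ := ∑ x, μ x * K x w y

/-- The mutual information `I(W;Y)` when `W ~ pW` and the independent input `X` has law `μ`. -/
def mixMI (pW : 𝒲 → ℝ) (K : 𝒳 → 𝒲 → 𝒴 → ℝ) (μ : 𝒳 → ℝ) : ℝ :=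
  ent pW + ent (fun y => ∑ w, pW w * mixCh K μ w y)
    - ent (fun z : 𝒲 × 𝒴 => pW z.1 * mixCh K μ z.1 z.2)

lemma ent_marginal_sub_ent {p : 𝒲 × 𝒴 → ℝ} (hp : ∀ z, 0 ≤ p z) :
    ent (fun y => ∑ w, p (w, y)) - ent p
      = ∑ z, p z * Real.log (p z / ∑ w, p (w, z.2)) := by
  have h : ∀ z, p z * Real.log (p z / ∑ w, p (w, z.2))
      = p z * Real.log (p z) - p z * Real.log (∑ w, p (w, z.2)) := by
    intro z
    rcases (hp z).eq_or_lt with h0 | h0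
    · simp [← h0]
    have : 0 < ∑ w, p (w, z.2) :=
      Finset.sum_pos' (fun w _ => hp _) ⟨z.1, Finset.mem_univ _, h0⟩
    rw [Real.log_div h0.ne' this.ne', mul_sub]
  simp only [h, Finset.sum_sub_distrib, ent]
  rw [Fintype.sum_prod_type_right (f := fun z => p z * Real.log (∑ w, p (w, z.2)))]
  simp only [Finset.sum_mul]
  ring

omit [Fintype 𝒲] [Fintype 𝒴] in
lemma mixCh_sum (K : 𝒳 → 𝒲 → 𝒴 → ℝ) (c : ι → ℝ) (μ : ι → 𝒳 → ℝ) (w : 𝒲) (y : 𝒴) :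
    mixCh K (fun x => ∑ i, c i * μ i x) w y = ∑ i, c i * mixCh K (μ i) w y := by
  simp only [mixCh, Finset.sum_mul, Finset.mul_sum, mul_assoc]
  exact Finset.sum_comm

omit [Fintype 𝒲] [Fintype 𝒴] in
lemma mixCh_nonneg {K : 𝒳 → 𝒲 → 𝒴 → ℝ} (hK : ∀ x w y, 0 ≤ K x w y) {μ : 𝒳 → ℝ}
    (hμ : ∀ x, 0 ≤ μ x) (w : 𝒲) (y : 𝒴) : 0 ≤ mixCh K μ w y :=
  Finset.sum_nonneg fun x _ => mul_nonneg (hμ x) (hK x w y)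

/-- Mutual information is convex in the channel. -/
lemma mixMI_sum_le {pW : 𝒲 → ℝ} {K : 𝒳 → 𝒲 → 𝒴 → ℝ} (hpW : ∀ w, 0 ≤ pW w)
    (hK : ∀ x w y, 0 ≤ K x w y) {c : ι → ℝ} (hc : ∀ i, 0 ≤ c i) (hc1 : ∑ i, c i = 1)
    {μ : ι → 𝒳 → ℝ} (hμ : ∀ i x, 0 ≤ μ i x) :
    mixMI pW K (fun x => ∑ i, c i * μ i x) ≤ ∑ i, c i * mixMI pW K (μ i) := by
  have hp : ∀ i w y, 0 ≤ pW w * mixCh K (μ i) w y := fun i w y =>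
    mul_nonneg (hpW w) (mixCh_nonneg hK (hμ i) w y)
  have hm : ∀ i y, 0 ≤ ∑ w, pW w * mixCh K (μ i) w y := fun i y =>
    Finset.sum_nonneg fun w _ => hp i w y
  have key : ∀ ν : 𝒳 → ℝ, (∀ x, 0 ≤ ν x) → mixMI pW K ν = ent pW + ∑ z : 𝒲 × 𝒴,
      pW z.1 * mixCh K ν z.1 z.2 *
        Real.log (pW z.1 * mixCh K ν z.1 z.2 / ∑ w, pW w * mixCh K ν w z.2) := by
    intro ν hν
    have := ent_marginal_sub_ent (p := fun z : 𝒲 × 𝒴 => pW z.1 * mixCh K ν z.1 z.2)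
      fun z => mul_nonneg (hpW _) (mixCh_nonneg hK hν _ _)
    rw [← this, mixMI]
    ring
  rw [key _ fun x => Finset.sum_nonneg fun i _ => mul_nonneg (hc i) (hμ i x)]
  simp only [key _ (hμ _), mul_add, Finset.sum_add_distrib, ← Finset.sum_mul, hc1, one_mul]
  refine add_le_add_right ?_ _
  simp only [Finset.mul_sum (s := (Finset.univ : Finset (𝒲 × 𝒴)))]
  rw [Finset.sum_comm]
  refine Finset.sum_le_sum fun z _ => ?_
  have h1 : pW z.1 * mixCh K (fun x => ∑ i, c i * μ i x) z.1 z.2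
      = ∑ i, c i * (pW z.1 * mixCh K (μ i) z.1 z.2) := by
    rw [mixCh_sum, Finset.mul_sum]
    exact Finset.sum_congr rfl fun i _ => by ring
  have h2 : ∑ w, pW w * mixCh K (fun x => ∑ i, c i * μ i x) w z.2
      = ∑ i, c i * ∑ w, pW w * mixCh K (μ i) w z.2 := by
    simp only [mixCh_sum, Finset.mul_sum]
    rw [Finset.sum_comm]
    exact Finset.sum_congr rfl fun i _ => Finset.sum_congr rfl fun w _ => by ring
  rw [h1, h2]
  refine (log_sum_le (fun i => mul_nonneg (hc i) (hp i _ _))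
    (fun i => mul_nonneg (hc i) (hm i _)) ?_).trans (Finset.sum_le_sum fun i _ => ?_)
  · intro i hi
    rcases mul_eq_zero.1 hi with h | h
    · simp [h]
    · rw [(Finset.sum_eq_zero_iff_of_nonneg fun w _ => hp i w z.2).1 h z.1 (Finset.mem_univ _),
        mul_zero]
  · rcases (hc i).eq_or_lt with h | h
    · simp [← h]
    · rw [mul_div_mul_left _ _ h.ne', mul_assoc]

end MixedInput

section Layered

variable {Ω α β 𝒳 𝒲 𝒴 : Type*} [Fintype Ω] [Fintype α] [Fintype β] [Fintype 𝒳] [Fintype 𝒲]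
  [Fintype 𝒴]

/-- Under `q`, the variables `U`, `V`, `W` are independent with laws `pU`, `pV`, `pW`, and `Y` is
the output of the channel `K` on the inputs `f(U,V)` and `W`. -/
structure IsLayered (q : Ω → ℝ) (U : Ω → α) (V : Ω → β) (W : Ω → 𝒲) (Y : Ω → 𝒴)
    (pU : α → ℝ) (pV : β → ℝ) (pW : 𝒲 → ℝ) (f : α → β → 𝒳) (K : 𝒳 → 𝒲 → 𝒴 → ℝ) : Prop where
  law : ∀ u v w y, pushf q (fun ω => (U ω, V ω, W ω, Y ω)) (u, v, w, y)
    = pU u * pV v * pW w * K (f u v) w y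
  sum_U : ∑ u, pU u = 1
  sum_V : ∑ v, pV v = 1
  sum_W : ∑ w, pW w = 1
  sum_K : ∀ x w, ∑ y, K x w y = 1

/-- The information `I(X,W;Y)` for independent inputs `X ~ pX` and `W ~ pW` of the channel `K`. -/
def totalMI (pX : 𝒳 → ℝ) (pW : 𝒲 → ℝ) (K : 𝒳 → 𝒲 → 𝒴 → ℝ) : ℝ :=
  ent (fun y => ∑ w, pW w * mixCh K pX w y) - ∑ x, pX x * ∑ w, pW w * ent (K x w)

namespace IsLayered

variable {q : Ω → ℝ} {U : Ω → α} {V : Ω → β} {W : Ω → 𝒲} {Y : Ω → 𝒴}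
  {pU : α → ℝ} {pV : β → ℝ} {pW : 𝒲 → ℝ} {f : α → β → 𝒳} {K : 𝒳 → 𝒲 → 𝒴 → ℝ}

lemma law_UWY (h : IsLayered q U V W Y pU pV pW f K) (u : α) (w : 𝒲) (y : 𝒴) :
    pushf q (fun ω => (U ω, W ω, Y ω)) (u, w, y)
      = pU u * (pW w * mixCh K (pushf pV (f u)) w y) := by
  rw [pushf_marginal q (B := V) (C := fun ω => (U ω, V ω, W ω, Y ω))
    (fun a b => (a.1, b, a.2.1, a.2.2)) (by simp only [Prod.ext_iff]; tauto)]
  simp only [h.law, mixCh, sum_pushf_mul pV (f u) fun x => K x w y, Finset.mul_sum]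
  exact Finset.sum_congr rfl fun v _ => by ring

omit [Fintype 𝒳] in
lemma law_UVW (h : IsLayered q U V W Y pU pV pW f K) (u : α) (v : β) (w : 𝒲) :
    pushf q (fun ω => (U ω, V ω, W ω)) (u, v, w) = pU u * pV v * pW w := by
  rw [pushf_marginal q (B := Y) (C := fun ω => (U ω, V ω, W ω, Y ω))
    (fun a b => (a.1, a.2.1, a.2.2, b)) (by simp only [Prod.ext_iff]; tauto)]
  simp only [h.law, ← Finset.mul_sum, h.sum_K, mul_one]

lemma law_UY (h : IsLayered q U V W Y pU pV pW f K) (u : α) (y : 𝒴) :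
    pushf q (fun ω => (U ω, Y ω)) (u, y)
      = pU u * ∑ w, pW w * mixCh K (pushf pV (f u)) w y := by
  rw [pushf_marginal q (B := W) (C := fun ω => (U ω, W ω, Y ω))
    (fun a b => (a.1, b, a.2)) (by simp only [Prod.ext_iff]; tauto)]
  simp only [h.law_UWY, Finset.mul_sum]

omit [Fintype 𝒳] in
lemma law_UW (h : IsLayered q U V W Y pU pV pW f K) (u : α) (w : 𝒲) :
    pushf q (fun ω => (U ω, W ω)) (u, w) = pU u * pW w := by
  rw [pushf_marginal q (B := V) (C := fun ω => (U ω, V ω, W ω))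
    (fun a b => (a.1, b, a.2)) (by simp only [Prod.ext_iff]; tauto)]
  simp only [h.law_UVW, ← Finset.mul_sum, ← Finset.sum_mul, h.sum_V, mul_one]

omit [Fintype 𝒳] in
lemma law_U (h : IsLayered q U V W Y pU pV pW f K) (u : α) : pushf q U u = pU u := by
  rw [pushf_marginal q (B := W) (C := fun ω => (U ω, W ω)) (fun a b => (a, b)) (by simp)]
  simp only [h.law_UW, ← Finset.mul_sum, h.sum_W, mul_one]

lemma sum_mixCh (h : IsLayered q U V W Y pU pV pW f K) (u : α) (w : 𝒲) :
    ∑ y, mixCh K (pushf pV (f u)) w y = 1 := by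
  simp only [mixCh]
  rw [Finset.sum_comm]
  simp only [← Finset.mul_sum, h.sum_K, mul_one, sum_pushf, h.sum_V]

/-- `I(W;Y|U)` is the average of the informations given `U = u`. -/
lemma cmi_W_Y_U (h : IsLayered q U V W Y pU pV pW f K) :
    cmiOf q W Y U = ∑ u, pU u * mixMI pW K (pushf pV (f u)) := by
  have hUW : Hof q (fun ω => (W ω, U ω)) = ent pU + ∑ u, pU u * ent pW := by
    rw [Hof_congr q (B := fun ω => (U ω, W ω)) (by simp [and_comm]), Hof,
      ← ent_mul_kernel pU (fun _ => pW) fun _ => h.sum_W]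
    exact congrArg ent (funext fun z => h.law_UW _ _)
  have hUY : Hof q (fun ω => (Y ω, U ω))
      = ent pU + ∑ u, pU u * ent (fun y => ∑ w, pW w * mixCh K (pushf pV (f u)) w y) := by
    rw [Hof_congr q (B := fun ω => (U ω, Y ω)) (by simp [and_comm]), Hof,
      ← ent_mul_kernel pU]
    · exact congrArg ent (funext fun z => h.law_UY _ _)
    · intro u
      rw [Finset.sum_comm]
      simp only [← Finset.mul_sum, h.sum_mixCh, mul_one, h.sum_W]
  have hUWY : Hof q (fun ω => (W ω, Y ω, U ω)) = ent pU + ∑ u, pU u *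
      ent (fun z : 𝒲 × 𝒴 => pW z.1 * mixCh K (pushf pV (f u)) z.1 z.2) := by
    rw [Hof_congr q (B := fun ω => (U ω, W ω, Y ω)) (by simp only [Prod.ext_iff]; tauto), Hof,
      ← ent_mul_kernel pU]
    · exact congrArg ent (funext fun z => h.law_UWY _ _ _)
    · intro u
      simp only [Fintype.sum_prod_type, ← Finset.mul_sum, h.sum_mixCh, mul_one, h.sum_W]
  have hU : Hof q U = ent pU := congrArg ent (funext h.law_U)
  rw [cmiOf, hUW, hUY, hUWY, hU]
  simp only [mixMI, mul_add, mul_sub, Finset.sum_add_distrib, Finset.sum_sub_distrib]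
  ring

lemma Hof_inputs_add_output_sub (h : IsLayered q U V W Y pU pV pW f K) {pX : 𝒳 → ℝ}
    (hX : ∀ x, ∑ u, pU u * pushf pV (f u) x = pX x) :
    Hof q (fun ω => (U ω, V ω, W ω)) + Hof q Y - Hof q (fun ω => (U ω, V ω, W ω, Y ω))
      = totalMI pX pW K := by
  have hX' : pX = fun x => ∑ u, pU u * pushf pV (f u) x := funext fun x => (hX x).symm
  have hY : pushf q Y = fun y => ∑ w, pW w * mixCh K pX w y := by
    funext y
    rw [pushf_marginal q (B := U) (C := fun ω => (U ω, Y ω)) (fun a b => (b, a))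
      (by simp [and_comm])]
    simp only [h.law_UY, hX', mixCh_sum, Finset.mul_sum]
    rw [Finset.sum_comm]
    exact Finset.sum_congr rfl fun w _ => Finset.sum_congr rfl fun u _ => by ring
  have hUVW : Hof q (fun ω => (U ω, V ω, W ω))
      = ent fun z : α × β × 𝒲 => pU z.1 * pV z.2.1 * pW z.2.2 :=
    congrArg ent (funext fun z => h.law_UVW _ _ _)
  have hall : Hof q (fun ω => (U ω, V ω, W ω, Y ω))
      = ent (fun z : α × β × 𝒲 => pU z.1 * pV z.2.1 * pW z.2.2)
        + ∑ z : α × β × 𝒲, pU z.1 * pV z.2.1 * pW z.2.2 * ent (K (f z.1 z.2.1) z.2.2) := by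
    rw [Hof_congr q (B := fun ω => ((U ω, V ω, W ω), Y ω)) (by simp only [Prod.ext_iff]; tauto),
      Hof, ← ent_mul_kernel _ _ fun z : α × β × 𝒲 => h.sum_K (f z.1 z.2.1) z.2.2]
    refine congrArg ent (funext fun z => ?_)
    rw [← h.law]
    simp only [pushf, Prod.ext_iff, and_assoc]
  have hE : ∑ z : α × β × 𝒲, pU z.1 * pV z.2.1 * pW z.2.2 * ent (K (f z.1 z.2.1) z.2.2)
      = ∑ x, pX x * ∑ w, pW w * ent (K x w) := by
    simp only [hX', Finset.sum_mul, Fintype.sum_prod_type]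
    rw [Finset.sum_comm (s := (Finset.univ : Finset 𝒳))]
    refine Finset.sum_congr rfl fun u _ => ?_
    simp only [mul_assoc, ← Finset.mul_sum]
    rw [sum_pushf_mul pV (f u) fun x => ∑ w, pW w * ent (K x w)]
  rw [hUVW, hall, hE, Hof, hY, totalMI]
  ring

lemma mi_add_cmi (h : IsLayered q U V W Y pU pV pW f K) {pX : 𝒳 → ℝ}
    (hX : ∀ x, ∑ u, pU u * pushf pV (f u) x = pX x) :
    miOf q U Y + cmiOf q V Y (fun ω => (U ω, W ω))
      = totalMI pX pW K - ∑ u, pU u * mixMI pW K (pushf pV (f u)) := by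
  rw [← h.Hof_inputs_add_output_sub hX, ← h.cmi_W_Y_U]
  have h1 : Hof q (fun ω => (V ω, U ω, W ω)) = Hof q (fun ω => (U ω, V ω, W ω)) :=
    Hof_congr q (by simp only [Prod.ext_iff]; tauto)
  have h2 : Hof q (fun ω => (V ω, Y ω, U ω, W ω)) = Hof q (fun ω => (U ω, V ω, W ω, Y ω)) :=
    Hof_congr q (by simp only [Prod.ext_iff]; tauto)
  have h3 : Hof q (fun ω => (Y ω, U ω, W ω)) = Hof q (fun ω => (W ω, Y ω, U ω)) :=
    Hof_congr q (by simp only [Prod.ext_iff]; tauto)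
  have h4 : Hof q (fun ω => (U ω, W ω)) = Hof q (fun ω => (W ω, U ω)) :=
    Hof_congr q (by simp only [Prod.ext_iff]; tauto)
  have h5 : Hof q (fun ω => (U ω, Y ω)) = Hof q (fun ω => (Y ω, U ω)) :=
    Hof_congr q (by simp only [Prod.ext_iff]; tauto)
  simp only [miOf, cmiOf, h1, h2, h3, h4, h5]
  ring

/-- The information at layer `U` lies between those without and with knowledge of the input. -/
lemma mixMI_bounds (h : IsLayered q U V W Y pU pV pW f K) {pX : 𝒳 → ℝ}
    (hX : ∀ x, ∑ u, pU u * pushf pV (f u) x = pX x) (hU : ∀ u, 0 ≤ pU u) (hV : ∀ v, 0 ≤ pV v)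
    (hW : ∀ w, 0 ≤ pW w) (hK : ∀ x w y, 0 ≤ K x w y) :
    mixMI pW K pX ≤ ∑ u, pU u * mixMI pW K (pushf pV (f u)) ∧
      ∑ u, pU u * mixMI pW K (pushf pV (f u)) ≤ ∑ x, pX x * mixMI pW K (Pi.single x 1) := by
  have hX' : pX = fun x => ∑ u, pU u * pushf pV (f u) x := funext fun x => (hX x).symm
  have hμ : ∀ u x, 0 ≤ pushf pV (f u) x := fun u x => pushf_nonneg hV (f u) x
  constructor
  · rw [hX']
    exact mixMI_sum_le hW hK hU h.sum_U hμ
  · have hu : ∀ u, mixMI pW K (pushf pV (f u))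
        ≤ ∑ x, pushf pV (f u) x * mixMI pW K (Pi.single x 1) := by
      intro u
      have hs : pushf pV (f u)
          = fun x => ∑ x', pushf pV (f u) x' * (Pi.single x' 1 : 𝒳 → ℝ) x := by
        funext x
        simp [Pi.single_apply]
      conv_lhs => rw [hs]
      refine mixMI_sum_le hW hK (hμ u) (by rw [sum_pushf, h.sum_V]) fun i x => ?_
      rw [Pi.single_apply]
      split_ifs <;> simp
    refine (Finset.sum_le_sum fun u _ => mul_le_mul_of_nonneg_left (hu u) (hU u)).trans_eq ?_
    simp only [hX', Finset.sum_mul, Finset.mul_sum, mul_assoc]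
    exact Finset.sum_comm

end IsLayered

omit [Fintype 𝒳] in
lemma pushf_const {p : Ω → ℝ} (hp : ∑ ω, p ω = 1) (x : 𝒳) :
    pushf p (fun _ => x) = Pi.single x 1 := by
  funext x'
  by_cases hx : x = x' <;> simp [pushf, hp, hx, eq_comm]

/-- The informations defining the simultaneous decoding region. -/
lemma mi_of_product_inputs {q : Ω → ℝ} {X : Ω → 𝒳} {W : Ω → 𝒲} {Y : Ω → 𝒴} {pX : 𝒳 → ℝ}
    {pW : 𝒲 → ℝ} {K : 𝒳 → 𝒲 → 𝒴 → ℝ}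
    (law : ∀ x w y, pushf q (fun ω => (X ω, W ω, Y ω)) (x, w, y) = pX x * pW w * K x w y)
    (hX : ∑ x, pX x = 1) (hW : ∑ w, pW w = 1) (hK : ∀ x w, ∑ y, K x w y = 1) :
    cmiOf q X Y W = totalMI pX pW K - mixMI pW K pX ∧
      cmiOf q W Y X = ∑ x, pX x * mixMI pW K (Pi.single x 1) ∧
      miOf q (fun ω => (X ω, W ω)) Y = totalMI pX pW K := by
  have h₀ : IsLayered q (fun _ => ()) X W Y (fun _ => 1) pX pW (fun _ x => x) K :=
    { law := fun u x w y => by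
        rw [one_mul, ← law]
        simp [pushf, Prod.ext_iff]
      sum_U := by simp
      sum_V := hX
      sum_W := hW
      sum_K := hK }
  have h₁ : IsLayered q X (fun _ => ()) W Y pX (fun _ => 1) pW (fun x _ => x) K :=
    { law := fun u x w y => by
        rw [mul_one, ← law]
        simp [pushf, Prod.ext_iff]
      sum_U := hX
      sum_V := by simp
      sum_W := hW
      sum_K := hK }
  have hX₀ : ∀ x, ∑ _u : Unit, (1 : ℝ) * pushf pX (fun x => x) x = pX x := by
    simp [pushf_id]
  have e₀ := h₀.cmi_W_Y_U
  have e₁ := h₁.cmi_W_Y_U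
  have e₂ := h₀.Hof_inputs_add_output_sub hX₀
  have hpt : ∀ x : 𝒳, pushf (fun _ : Unit => (1 : ℝ)) (fun _ => x) = Pi.single x 1 :=
    fun x => pushf_const (by simp) x
  simp only [pushf_id, Finset.univ_unique, Finset.sum_const, Finset.card_singleton, one_smul,
    one_mul] at e₀
  simp only [hpt] at e₁
  have hc : Hof q (fun _ => ()) = 0 := by
    rw [Hof, funext h₀.law_U]
    simp [ent]
  have r₁ : Hof q (fun ω => ((), X ω, W ω)) = Hof q (fun ω => (X ω, W ω)) :=
    Hof_congr q (by simp)
  have r₂ : Hof q (fun ω => ((), X ω, W ω, Y ω)) = Hof q (fun ω => (X ω, Y ω, W ω)) :=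
    Hof_congr q (by simp only [Prod.ext_iff]; tauto)
  have r₃ : Hof q (fun ω => ((X ω, W ω), Y ω)) = Hof q (fun ω => (X ω, Y ω, W ω)) :=
    Hof_congr q (by simp only [Prod.ext_iff]; tauto)
  have r₄ : Hof q (fun ω => (W ω, ())) = Hof q W := Hof_congr q (by simp)
  have r₅ : Hof q (fun ω => (Y ω, ())) = Hof q Y := Hof_congr q (by simp)
  have r₆ : Hof q (fun ω => (W ω, Y ω, ())) = Hof q (fun ω => (Y ω, W ω)) :=
    Hof_congr q (by simp [and_comm])
  rw [r₁, r₂] at e₂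
  rw [cmiOf, r₄, r₅, r₆, hc] at e₀
  refine ⟨?_, e₁, ?_⟩
  · rw [cmiOf]
    linarith
  · rw [miOf, r₃, e₂]

section ThreeLayers

variable {A₁ A₂ A₃ : Type*} [Fintype A₁] [Fintype A₂] [Fintype A₃] {q : Ω → ℝ}
  {X₁ : Ω → A₁} {X₂ : Ω → A₂} {X₃ : Ω → A₃} {W : Ω → 𝒲} {Y : Ω → 𝒴} {p₁ : A₁ → ℝ} {p₂ : A₂ → ℝ}
  {p₃ : A₃ → ℝ} {pW : 𝒲 → ℝ} {f : A₁ → A₂ → A₃ → 𝒳} {K : 𝒳 → 𝒲 → 𝒴 → ℝ}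

omit [Fintype 𝒳] in
lemma isLayered_first
    (law : ∀ a b c w y, pushf q (fun ω => (X₁ ω, X₂ ω, X₃ ω, W ω, Y ω)) (a, b, c, w, y)
      = p₁ a * p₂ b * p₃ c * pW w * K (f a b c) w y)
    (h₁ : ∑ a, p₁ a = 1) (h₂ : ∑ b, p₂ b = 1) (h₃ : ∑ c, p₃ c = 1) (hW : ∑ w, pW w = 1)
    (hK : ∀ x w, ∑ y, K x w y = 1) :
    IsLayered q X₁ (fun ω => (X₂ ω, X₃ ω)) W Y p₁ (fun v => p₂ v.1 * p₃ v.2) pW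
      (fun a v => f a v.1 v.2) K where
  law u v w y := by
    rw [← mul_assoc, ← law]
    simp only [pushf, Prod.ext_iff, and_assoc]
  sum_U := h₁
  sum_V := by simp only [Fintype.sum_prod_type, ← Finset.mul_sum, h₃, mul_one, h₂]
  sum_W := hW
  sum_K := hK

omit [Fintype 𝒳] in
lemma isLayered_second
    (law : ∀ a b c w y, pushf q (fun ω => (X₁ ω, X₂ ω, X₃ ω, W ω, Y ω)) (a, b, c, w, y)
      = p₁ a * p₂ b * p₃ c * pW w * K (f a b c) w y)
    (h₁ : ∑ a, p₁ a = 1) (h₂ : ∑ b, p₂ b = 1) (h₃ : ∑ c, p₃ c = 1) (hW : ∑ w, pW w = 1)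
    (hK : ∀ x w, ∑ y, K x w y = 1) :
    IsLayered q (fun ω => (X₁ ω, X₂ ω)) X₃ W Y (fun u => p₁ u.1 * p₂ u.2) p₃ pW
      (fun u c => f u.1 u.2 c) K where
  law u v w y := by
    rw [← law]
    simp only [pushf, Prod.ext_iff, and_assoc]
  sum_U := by simp only [Fintype.sum_prod_type, ← Finset.mul_sum, h₂, mul_one, h₁]
  sum_V := h₃
  sum_W := hW
  sum_K := hK

end ThreeLayers

end Layered

section Channel

variable {𝒳 𝒲 𝒴₁ 𝒴₂ : Type} [Fintype 𝒳] [Fintype 𝒲] [Fintype 𝒴₁] [Fintype 𝒴₂]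

/-- The channel from both inputs to the first receiver. -/
def recv₁ (ch : 𝒳 → 𝒲 → 𝒴₁ → 𝒴₂ → ℝ) (x : 𝒳) (w : 𝒲) (y₁ : 𝒴₁) : ℝ := ∑ y₂, ch x w y₁ y₂

/-- The channel from both inputs to the second receiver. -/
def recv₂ (ch : 𝒳 → 𝒲 → 𝒴₁ → 𝒴₂ → ℝ) (x : 𝒳) (w : 𝒲) (y₂ : 𝒴₂) : ℝ := ∑ y₁, ch x w y₁ y₂

lemma icJoint_law₁ (pX : 𝒳 → ℝ) (pW : 𝒲 → ℝ) (ch : 𝒳 → 𝒲 → 𝒴₁ → 𝒴₂ → ℝ) (x : 𝒳) (w : 𝒲)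
    (y : 𝒴₁) : pushf (icJoint pX pW ch) (fun ω => (ω.1, ω.2.1, ω.2.2.1)) (x, w, y)
      = pX x * pW w * recv₁ ch x w y := by
  rw [pushf_marginal _ (B := fun ω => ω.2.2.2) (C := fun ω => ω)
    (fun a b => (a.1, a.2.1, a.2.2, b)) (by simp only [Prod.ext_iff]; tauto), pushf_id]
  simp only [icJoint, recv₁, Finset.mul_sum]

lemma icJoint_law₂ (pX : 𝒳 → ℝ) (pW : 𝒲 → ℝ) (ch : 𝒳 → 𝒲 → 𝒴₁ → 𝒴₂ → ℝ) (x : 𝒳) (w : 𝒲)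
    (y : 𝒴₂) : pushf (icJoint pX pW ch) (fun ω => (ω.1, ω.2.1, ω.2.2.2)) (x, w, y)
      = pX x * pW w * recv₂ ch x w y := by
  rw [pushf_marginal _ (B := fun ω => ω.2.2.1) (C := fun ω => ω)
    (fun a b => (a.1, a.2.1, b, a.2.2)) (by simp only [Prod.ext_iff]; tauto), pushf_id]
  simp only [icJoint, recv₂, Finset.mul_sum]

lemma swJoint3_law₁ (s : SplitDist3 𝒳 𝒲) (ch : 𝒳 → 𝒲 → 𝒴₁ → 𝒴₂ → ℝ) (a : s.A1) (b : s.A2)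
    (c : s.A3) (w : 𝒲) (y : 𝒴₁) :
    pushf (swJoint3 s ch) (fun ω => (ω.1, ω.2.1, ω.2.2.1, ω.2.2.2.1, ω.2.2.2.2.1)) (a, b, c, w, y)
      = s.p1 a * s.p2 b * s.p3 c * s.pw w * recv₁ ch (s.f a b c) w y := by
  rw [pushf_marginal _ (B := fun ω => ω.2.2.2.2.2) (C := fun ω => ω)
    (fun a b => (a.1, a.2.1, a.2.2.1, a.2.2.2.1, a.2.2.2.2, b))
    (by simp only [Prod.ext_iff]; tauto), pushf_id]
  simp only [swJoint3, recv₁, Finset.mul_sum]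

lemma swJoint3_law₂ (s : SplitDist3 𝒳 𝒲) (ch : 𝒳 → 𝒲 → 𝒴₁ → 𝒴₂ → ℝ) (a : s.A1) (b : s.A2)
    (c : s.A3) (w : 𝒲) (y : 𝒴₂) :
    pushf (swJoint3 s ch) (fun ω => (ω.1, ω.2.1, ω.2.2.1, ω.2.2.2.1, ω.2.2.2.2.2)) (a, b, c, w, y)
      = s.p1 a * s.p2 b * s.p3 c * s.pw w * recv₂ ch (s.f a b c) w y := by
  rw [pushf_marginal _ (B := fun ω => ω.2.2.2.2.1) (C := fun ω => ω)
    (fun a b => (a.1, a.2.1, a.2.2.1, a.2.2.2.1, b, a.2.2.2.2))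
    (by simp only [Prod.ext_iff]; tauto), pushf_id]
  simp only [swJoint3, recv₂, Finset.mul_sum]

omit [Fintype 𝒳] [Fintype 𝒲] [Fintype 𝒴₁] in
lemma recv₁_nonneg {ch : 𝒳 → 𝒲 → 𝒴₁ → 𝒴₂ → ℝ} (hch0 : ∀ x w y₁ y₂, 0 ≤ ch x w y₁ y₂)
    (x : 𝒳) (w : 𝒲) (y : 𝒴₁) : 0 ≤ recv₁ ch x w y :=
  Finset.sum_nonneg fun _ _ => hch0 _ _ _ _

omit [Fintype 𝒳] [Fintype 𝒲] [Fintype 𝒴₂] in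
lemma recv₂_nonneg {ch : 𝒳 → 𝒲 → 𝒴₁ → 𝒴₂ → ℝ} (hch0 : ∀ x w y₁ y₂, 0 ≤ ch x w y₁ y₂)
    (x : 𝒳) (w : 𝒲) (y : 𝒴₂) : 0 ≤ recv₂ ch x w y :=
  Finset.sum_nonneg fun _ _ => hch0 _ _ _ _

omit [Fintype 𝒳] [Fintype 𝒲] in
lemma sum_recv₂ {ch : 𝒳 → 𝒲 → 𝒴₁ → 𝒴₂ → ℝ} (hch1 : ∀ x w, ∑ y₁, ∑ y₂, ch x w y₁ y₂ = 1)
    (x : 𝒳) (w : 𝒲) : ∑ y, recv₂ ch x w y = 1 :=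
  Finset.sum_comm.trans (hch1 x w)

lemma mem_R1SD_iff {pX : 𝒳 → ℝ} {pW : 𝒲 → ℝ} {ch : 𝒳 → 𝒲 → 𝒴₁ → 𝒴₂ → ℝ} (hpX : IsPMF pX)
    (hpW : IsPMF pW) (hch1 : ∀ x w, ∑ y₁, ∑ y₂, ch x w y₁ y₂ = 1) (R : ℝ × ℝ) :
    R ∈ R1SD pX pW ch ↔ 0 ≤ R.1 ∧ 0 ≤ R.2 ∧
      R.1 ≤ totalMI pX pW (recv₁ ch) - mixMI pW (recv₁ ch) pX ∧
      R.2 ≤ ∑ x, pX x * mixMI pW (recv₁ ch) (Pi.single x 1) ∧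
      R.1 + R.2 ≤ totalMI pX pW (recv₁ ch) := by
  obtain ⟨h₁, h₂, h₃⟩ := mi_of_product_inputs (icJoint_law₁ pX pW ch) hpX.2 hpW.2 hch1
  rw [← h₁, ← h₂, ← h₃]
  rfl

lemma mem_R2SD_iff {pX : 𝒳 → ℝ} {pW : 𝒲 → ℝ} {ch : 𝒳 → 𝒲 → 𝒴₁ → 𝒴₂ → ℝ} (hpX : IsPMF pX)
    (hpW : IsPMF pW) (hch1 : ∀ x w, ∑ y₁, ∑ y₂, ch x w y₁ y₂ = 1) (R : ℝ × ℝ) :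
    R ∈ R2SD pX pW ch ↔ 0 ≤ R.1 ∧ 0 ≤ R.2 ∧
      R.1 ≤ totalMI pX pW (recv₂ ch) - mixMI pW (recv₂ ch) pX ∧
      R.2 ≤ ∑ x, pX x * mixMI pW (recv₂ ch) (Pi.single x 1) ∧
      R.1 + R.2 ≤ totalMI pX pW (recv₂ ch) := by
  obtain ⟨h₁, h₂, h₃⟩ :=
    mi_of_product_inputs (icJoint_law₂ pX pW ch) hpX.2 hpW.2 (sum_recv₂ hch1)
  rw [← h₁, ← h₂, ← h₃]
  rfl

end Channel

namespace SplitDist3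

variable {𝒳 𝒲 𝒴₁ 𝒴₂ : Type} [Fintype 𝒳] [Fintype 𝒲] [Fintype 𝒴₁] [Fintype 𝒴₂]

/-- The information `I(W;Y|X₁)` at the output `Y` of the channel `K`. -/
def firstMI {𝒴 : Type*} [Fintype 𝒴] (s : SplitDist3 𝒳 𝒲) (K : 𝒳 → 𝒲 → 𝒴 → ℝ) : ℝ :=
  ∑ u, s.p1 u *
    mixMI s.pw K (pushf (fun v : s.A2 × s.A3 => s.p2 v.1 * s.p3 v.2) fun v => s.f u v.1 v.2)

/-- The information `I(W;Y|X₁,X₂)` at the output `Y` of the channel `K`. -/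
def secondMI {𝒴 : Type*} [Fintype 𝒴] (s : SplitDist3 𝒳 𝒲) (K : 𝒳 → 𝒲 → 𝒴 → ℝ) : ℝ :=
  ∑ u : s.A1 × s.A2, s.p1 u.1 * s.p2 u.2 *
    mixMI s.pw K (pushf s.p3 fun c => s.f u.1 u.2 c)

variable {s : SplitDist3 𝒳 𝒲} {pX : 𝒳 → ℝ} {pW : 𝒲 → ℝ} {ch : 𝒳 → 𝒲 → 𝒴₁ → 𝒴₂ → ℝ}

lemma Matches.input_first (hm : s.Matches pX pW) (x : 𝒳) :
    ∑ u, s.p1 u *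
      pushf (fun v : s.A2 × s.A3 => s.p2 v.1 * s.p3 v.2) (fun v => s.f u v.1 v.2) x = pX x := by
  rw [← hm.1 x]
  simp only [pushf, Fintype.sum_prod_type, Finset.mul_sum, mul_ite, mul_zero, mul_assoc]

lemma Matches.input_second (hm : s.Matches pX pW) (x : 𝒳) :
    ∑ u : s.A1 × s.A2, s.p1 u.1 * s.p2 u.2 * pushf s.p3 (fun c => s.f u.1 u.2 c) x = pX x := by
  rw [← hm.1 x]
  simp only [pushf, Fintype.sum_prod_type, Finset.mul_sum, mul_ite, mul_zero, mul_assoc]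

lemma isLayered_first₁ (s : SplitDist3 𝒳 𝒲) (hch1 : ∀ x w, ∑ y₁, ∑ y₂, ch x w y₁ y₂ = 1) :
    IsLayered (swJoint3 s ch) (fun ω => ω.1) (fun ω => (ω.2.1, ω.2.2.1)) (fun ω => ω.2.2.2.1)
      (fun ω => ω.2.2.2.2.1) s.p1 (fun v => s.p2 v.1 * s.p3 v.2) s.pw (fun a v => s.f a v.1 v.2)
      (recv₁ ch) :=
  isLayered_first (swJoint3_law₁ s ch) s.p1_pmf.2 s.p2_pmf.2 s.p3_pmf.2 s.pw_pmf.2 hch1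

lemma isLayered_second₁ (s : SplitDist3 𝒳 𝒲) (hch1 : ∀ x w, ∑ y₁, ∑ y₂, ch x w y₁ y₂ = 1) :
    IsLayered (swJoint3 s ch) (fun ω => (ω.1, ω.2.1)) (fun ω => ω.2.2.1) (fun ω => ω.2.2.2.1)
      (fun ω => ω.2.2.2.2.1) (fun u => s.p1 u.1 * s.p2 u.2) s.p3 s.pw (fun u c => s.f u.1 u.2 c)
      (recv₁ ch) :=
  isLayered_second (swJoint3_law₁ s ch) s.p1_pmf.2 s.p2_pmf.2 s.p3_pmf.2 s.pw_pmf.2 hch1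

lemma isLayered_first₂ (s : SplitDist3 𝒳 𝒲) (hch1 : ∀ x w, ∑ y₁, ∑ y₂, ch x w y₁ y₂ = 1) :
    IsLayered (swJoint3 s ch) (fun ω => ω.1) (fun ω => (ω.2.1, ω.2.2.1)) (fun ω => ω.2.2.2.1)
      (fun ω => ω.2.2.2.2.2) s.p1 (fun v => s.p2 v.1 * s.p3 v.2) s.pw (fun a v => s.f a v.1 v.2)
      (recv₂ ch) :=
  isLayered_first (swJoint3_law₂ s ch) s.p1_pmf.2 s.p2_pmf.2 s.p3_pmf.2 s.pw_pmf.2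
    (sum_recv₂ hch1)

lemma isLayered_second₂ (s : SplitDist3 𝒳 𝒲) (hch1 : ∀ x w, ∑ y₁, ∑ y₂, ch x w y₁ y₂ = 1) :
    IsLayered (swJoint3 s ch) (fun ω => (ω.1, ω.2.1)) (fun ω => ω.2.2.1) (fun ω => ω.2.2.2.1)
      (fun ω => ω.2.2.2.2.2) (fun u => s.p1 u.1 * s.p2 u.2) s.p3 s.pw (fun u c => s.f u.1 u.2 c)
      (recv₂ ch) :=
  isLayered_second (swJoint3_law₂ s ch) s.p1_pmf.2 s.p2_pmf.2 s.p3_pmf.2 s.pw_pmf.2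
    (sum_recv₂ hch1)

lemma Matches.mem_RSWSC31A_iff (hm : s.Matches pX pW)
    (hch1 : ∀ x w, ∑ y₁, ∑ y₂, ch x w y₁ y₂ = 1) (R : ℝ × ℝ) :
    R ∈ RSWSC31A s ch ↔ 0 ≤ R.1 ∧ 0 ≤ R.2 ∧
      R.1 ≤ min (totalMI pX s.pw (recv₁ ch) - s.firstMI (recv₁ ch))
        (totalMI pX s.pw (recv₂ ch) - s.secondMI (recv₂ ch)) ∧
      R.2 ≤ min (s.firstMI (recv₁ ch)) (s.secondMI (recv₂ ch)) := by
  have h₁ := s.isLayered_first₁ hch1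
  have h₂ := s.isLayered_second₂ hch1
  rw [firstMI, secondMI, ← h₁.mi_add_cmi hm.input_first, ← h₂.mi_add_cmi hm.input_second,
    ← h₁.cmi_W_Y_U, ← h₂.cmi_W_Y_U,
    cmiOf_congr_cond (swJoint3 s ch) _ _
      (C := fun ω => ((ω.1, ω.2.1), ω.2.2.2.1)) (D := fun ω => (ω.1, ω.2.1, ω.2.2.2.1))
      (by simp only [Prod.ext_iff]; tauto)]
  rfl

lemma Matches.mem_RSWSC31B_iff (hm : s.Matches pX pW)
    (hch1 : ∀ x w, ∑ y₁, ∑ y₂, ch x w y₁ y₂ = 1) (R : ℝ × ℝ) :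
    R ∈ RSWSC31B s ch ↔ 0 ≤ R.1 ∧ 0 ≤ R.2 ∧
      R.1 ≤ min (totalMI pX s.pw (recv₁ ch) - s.secondMI (recv₁ ch))
        (totalMI pX s.pw (recv₂ ch) - s.firstMI (recv₂ ch)) ∧
      R.2 ≤ min (s.firstMI (recv₂ ch)) (s.secondMI (recv₁ ch)) := by
  have h₁ := s.isLayered_second₁ hch1
  have h₂ := s.isLayered_first₂ hch1
  rw [firstMI, secondMI, ← h₁.mi_add_cmi hm.input_second, ← h₂.mi_add_cmi hm.input_first,
    ← h₁.cmi_W_Y_U, ← h₂.cmi_W_Y_U,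
    cmiOf_congr_cond (swJoint3 s ch) _ _
      (C := fun ω => ((ω.1, ω.2.1), ω.2.2.2.1)) (D := fun ω => (ω.1, ω.2.1, ω.2.2.2.1))
      (by simp only [Prod.ext_iff]; tauto)]
  rfl

lemma Matches.MI_bounds₁ (hm : s.Matches pX pW) (hch0 : ∀ x w y₁ y₂, 0 ≤ ch x w y₁ y₂)
    (hch1 : ∀ x w, ∑ y₁, ∑ y₂, ch x w y₁ y₂ = 1) :
    s.firstMI (recv₁ ch) ∈ Set.Icc (mixMI s.pw (recv₁ ch) pX)
      (∑ x, pX x * mixMI s.pw (recv₁ ch) (Pi.single x 1)) ∧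
    s.secondMI (recv₁ ch) ∈ Set.Icc (mixMI s.pw (recv₁ ch) pX)
      (∑ x, pX x * mixMI s.pw (recv₁ ch) (Pi.single x 1)) :=
  ⟨(s.isLayered_first₁ hch1).mixMI_bounds hm.input_first s.p1_pmf.1
      (fun _ => mul_nonneg (s.p2_pmf.1 _) (s.p3_pmf.1 _)) s.pw_pmf.1 (recv₁_nonneg hch0),
    (s.isLayered_second₁ hch1).mixMI_bounds hm.input_second
      (fun _ => mul_nonneg (s.p1_pmf.1 _) (s.p2_pmf.1 _)) s.p3_pmf.1 s.pw_pmf.1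
      (recv₁_nonneg hch0)⟩

lemma Matches.MI_bounds₂ (hm : s.Matches pX pW) (hch0 : ∀ x w y₁ y₂, 0 ≤ ch x w y₁ y₂)
    (hch1 : ∀ x w, ∑ y₁, ∑ y₂, ch x w y₁ y₂ = 1) :
    s.firstMI (recv₂ ch) ∈ Set.Icc (mixMI s.pw (recv₂ ch) pX)
      (∑ x, pX x * mixMI s.pw (recv₂ ch) (Pi.single x 1)) ∧
    s.secondMI (recv₂ ch) ∈ Set.Icc (mixMI s.pw (recv₂ ch) pX)
      (∑ x, pX x * mixMI s.pw (recv₂ ch) (Pi.single x 1)) :=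
  ⟨(s.isLayered_first₂ hch1).mixMI_bounds hm.input_first s.p1_pmf.1
      (fun _ => mul_nonneg (s.p2_pmf.1 _) (s.p3_pmf.1 _)) s.pw_pmf.1 (recv₂_nonneg hch0),
    (s.isLayered_second₂ hch1).mixMI_bounds hm.input_second
      (fun _ => mul_nonneg (s.p1_pmf.1 _) (s.p2_pmf.1 _)) s.p3_pmf.1 s.pw_pmf.1
      (recv₂_nonneg hch0)⟩

end SplitDist3

section Erasure

variable {𝒳 𝒲 : Type} [Fintype 𝒳] [Fintype 𝒲]

/-- The law of a symbol `X ~ p` that is kept with probability `t` and erased otherwise. -/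
def erasePmf (t : ℝ) (p : 𝒳 → ℝ) (o : Option 𝒳) : ℝ := o.elim (1 - t) fun x => t * p x

omit [Fintype 𝒳] in
lemma erasePmf_none (t : ℝ) (p : 𝒳 → ℝ) : erasePmf t p none = 1 - t := rfl

omit [Fintype 𝒳] in
lemma erasePmf_some (t : ℝ) (p : 𝒳 → ℝ) (x : 𝒳) : erasePmf t p (some x) = t * p x := rfl

lemma isPMF_erasePmf {t : ℝ} (ht0 : 0 ≤ t) (ht1 : t ≤ 1) {p : 𝒳 → ℝ} (hp : IsPMF p) :
    IsPMF (erasePmf t p) := by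
  constructor
  · rintro (_ | x)
    · simpa [erasePmf] using ht1
    · exact mul_nonneg ht0 (hp.1 x)
  · simp [Fintype.sum_option, erasePmf, ← Finset.mul_sum, hp.2]

/-- Filling in an erased symbol. -/
lemma pushf_erase_getD {β : Type*} [Fintype β] (t : ℝ) (p : 𝒳 → ℝ) {q : β → ℝ}
    (hq : ∑ b, q b = 1) (g : β → 𝒳) :
    pushf (fun z : Option 𝒳 × β => erasePmf t p z.1 * q z.2) (fun z => z.1.getD (g z.2))
      = fun x => (1 - t) * pushf q g x + t * p x := by
  funext x
  simp only [pushf, Fintype.sum_prod_type, Fintype.sum_option, erasePmf_none, erasePmf_some,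
    Option.getD_none, Option.getD_some, Finset.mul_sum, mul_ite, mul_zero]
  congr 1
  rw [Finset.sum_eq_single x] <;> simp +contextual [← Finset.mul_sum, hq]

lemma pushf_erase_getD_self {β : Type*} [Fintype β] (t : ℝ) (p : 𝒳 → ℝ) {q : β → ℝ}
    (hq : ∑ b, q b = 1) {g : β → 𝒳} (hg : pushf q g = p) :
    pushf (fun z : Option 𝒳 × β => erasePmf t p z.1 * q z.2) (fun z => z.1.getD (g z.2)) = p := by
  rw [pushf_erase_getD t p hq, hg]
  funext x
  ring

/-- The split in which `X₁` and `X₂` are erased copies of `X`, and the first unerased symbol of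
`X₁`, `X₂`, `X₃` is sent. -/
def erasureSplit {pX : 𝒳 → ℝ} {pW : 𝒲 → ℝ} (hpX : IsPMF pX) (hpW : IsPMF pW) {t r : ℝ}
    (ht0 : 0 ≤ t) (ht1 : t ≤ 1) (hr0 : 0 ≤ r) (hr1 : r ≤ 1) : SplitDist3 𝒳 𝒲 where
  A1 := Option 𝒳
  A2 := Option 𝒳
  A3 := 𝒳
  p1 := erasePmf t pX
  p2 := erasePmf r pX
  p3 := pX
  pw := pW
  f a b c := a.getD (b.getD c)
  p1_pmf := isPMF_erasePmf ht0 ht1 hpX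
  p2_pmf := isPMF_erasePmf hr0 hr1 hpX
  p3_pmf := hpX
  pw_pmf := hpW

variable {pX : 𝒳 → ℝ} {pW : 𝒲 → ℝ} (hpX : IsPMF pX) (hpW : IsPMF pW) {t r : ℝ}
  (ht0 : 0 ≤ t) (ht1 : t ≤ 1) (hr0 : 0 ≤ r) (hr1 : r ≤ 1)

lemma erasureSplit_matches : (erasureSplit hpX hpW ht0 ht1 hr0 hr1).Matches pX pW := by
  refine ⟨fun x => ?_, rfl⟩
  have h₂ := pushf_erase_getD_self r pX hpX.2 (pushf_id pX)
  have hq : ∑ z : Option 𝒳 × 𝒳, erasePmf r pX z.1 * pX z.2 = 1 := by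
    simp only [Fintype.sum_prod_type, ← Finset.mul_sum, hpX.2, mul_one,
      (isPMF_erasePmf hr0 hr1 hpX).2]
  have h₁ := congrFun (pushf_erase_getD_self t pX hq h₂) x
  simp only [← mul_assoc] at h₁
  exact h₁

variable {𝒴 : Type*} [Fintype 𝒴] (K : 𝒳 → 𝒲 → 𝒴 → ℝ)

lemma erasureSplit_firstMI : (erasureSplit hpX hpW ht0 ht1 hr0 hr1).firstMI K
    = (1 - t) * mixMI pW K pX + t * ∑ x, pX x * mixMI pW K (Pi.single x 1) := by
  have h₂ := pushf_erase_getD_self r pX hpX.2 (pushf_id pX)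
  have hq : ∑ z : Option 𝒳 × 𝒳, erasePmf r pX z.1 * pX z.2 = 1 := by
    simp only [Fintype.sum_prod_type, ← Finset.mul_sum, hpX.2, mul_one,
      (isPMF_erasePmf hr0 hr1 hpX).2]
  change ∑ u : Option 𝒳, erasePmf t pX u * mixMI pW K
    (pushf (fun v : Option 𝒳 × 𝒳 => erasePmf r pX v.1 * pX v.2) fun v => u.getD (v.1.getD v.2)) = _
  rw [Fintype.sum_option]
  simp only [Option.getD_none, Option.getD_some, h₂, pushf_const hq, erasePmf_none, erasePmf_some,
    Finset.mul_sum, mul_assoc]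

lemma erasureSplit_secondMI : (erasureSplit hpX hpW ht0 ht1 hr0 hr1).secondMI K
    = (1 - t) * (1 - r) * mixMI pW K pX
      + (1 - (1 - t) * (1 - r)) * ∑ x, pX x * mixMI pW K (Pi.single x 1) := by
  change ∑ u : Option 𝒳 × Option 𝒳, erasePmf t pX u.1 * erasePmf r pX u.2 * mixMI pW K
    (pushf pX fun c => u.1.getD (u.2.getD c)) = _
  have hr := (isPMF_erasePmf hr0 hr1 hpX).2
  have hs : ∀ x : 𝒳, ∑ o, t * pX x * erasePmf r pX o * mixMI pW K (Pi.single x 1)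
      = t * (pX x * mixMI pW K (Pi.single x 1)) := fun x => by
    rw [← Finset.sum_mul, ← Finset.mul_sum, hr]
    ring
  rw [Fintype.sum_prod_type, Fintype.sum_option]
  simp only [Option.getD_some, Option.getD_none, pushf_const hpX.2]
  simp only [erasePmf_some t, hs]
  rw [Fintype.sum_option]
  simp only [Option.getD_some, Option.getD_none, pushf_const hpX.2, pushf_id]
  simp only [erasePmf_none, erasePmf_some, ← Finset.mul_sum, mul_assoc]
  ring

end Erasure

/-- A point of a pentagonal region lies below a corner obtained by interpolation. -/
lemma exists_interpolation {a b T R₁ R₂ : ℝ} (h₁ : R₁ ≤ T - a) (h₂ : R₂ ≤ b)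
    (h₃ : R₁ + R₂ ≤ T) :
    ∃ t : ℝ, 0 ≤ t ∧ t ≤ 1 ∧ R₁ ≤ T - ((1 - t) * a + t * b) ∧ R₂ ≤ (1 - t) * a + t * b := by
  rcases le_total R₂ a with h | h
  · exact ⟨0, le_rfl, zero_le_one, by linarith, by linarith⟩
  rcases h.eq_or_lt with rfl | h
  · exact ⟨0, le_rfl, zero_le_one, by linarith, by linarith⟩
  have hab : 0 < b - a := by linarith
  have ht : (1 - (R₂ - a) / (b - a)) * a + (R₂ - a) / (b - a) * b = R₂ := by
    field_simp
    ring
  refine ⟨(R₂ - a) / (b - a), by apply div_nonneg <;> linarith,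
    by rw [div_le_one hab]; linarith, ?_, ?_⟩ <;> rw [ht]
  linarith

lemma exists_complement_factor {s t : ℝ} (hst : s ≤ t) (ht : t ≤ 1) :
    ∃ r : ℝ, 0 ≤ r ∧ r ≤ 1 ∧ (1 - s) * (1 - r) = 1 - t := by
  rcases (hst.trans ht).eq_or_lt with rfl | hs
  · exact ⟨0, le_rfl, zero_le_one, by linarith⟩
  have hs' : 0 < 1 - s := by linarith
  refine ⟨(t - s) / (1 - s), by apply div_nonneg <;> linarith,
    by rw [div_le_one hs']; linarith, ?_⟩
  field_simp
  ring

/-- Proposition 2: `𝓡₁,SD(p) ∩ 𝓡₂,SD(p)` equals the union over all three-layer split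
distributions `p' ≃ p` and the two decoding-order pairs of `𝓡_SWSC(p',3,1,d₁,d₂)`. -/
theorem swsc_31_achieves_sd
    (pX : 𝒳 → ℝ) (pW : 𝒲 → ℝ) (ch : 𝒳 → 𝒲 → 𝒴₁ → 𝒴₂ → ℝ)
    (hpX : IsPMF pX) (hpW : IsPMF pW)
    (hch0 : ∀ x w y₁ y₂, 0 ≤ ch x w y₁ y₂)
    (hch1 : ∀ x w, ∑ y₁, ∑ y₂, ch x w y₁ y₂ = 1) :
    R1SD pX pW ch ∩ R2SD pX pW ch
      = ⋃ (s : SplitDist3 𝒳 𝒲) (_ : s.Matches pX pW), (RSWSC31A s ch ∪ RSWSC31B s ch) := by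
  ext R
  simp only [Set.mem_inter_iff, mem_R1SD_iff hpX hpW hch1, mem_R2SD_iff hpX hpW hch1,
    Set.mem_iUnion, Set.mem_union]
  constructor
  · rintro ⟨⟨h0, h0', h₁, h₂, h₃⟩, -, -, k₁, k₂, k₃⟩
    obtain ⟨t₁, ht₁0, ht₁1, ha₁, hb₁⟩ := exists_interpolation h₁ h₂ h₃
    obtain ⟨t₂, ht₂0, ht₂1, ha₂, hb₂⟩ := exists_interpolation k₁ k₂ k₃
    rcases le_total t₁ t₂ with h | h
    · obtain ⟨r, hr0, hr1, hr⟩ := exists_complement_factor h ht₂1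
      have hm := erasureSplit_matches hpX hpW ht₁0 ht₁1 hr0 hr1
      refine ⟨_, hm, Or.inl ((hm.mem_RSWSC31A_iff hch1 R).2 ⟨h0, h0', ?_, ?_⟩)⟩ <;>
      simp only [erasureSplit_firstMI, erasureSplit_secondMI, hr, le_min_iff,
        sub_sub_cancel]
      · exact ⟨ha₁, ha₂⟩
      · exact ⟨hb₁, hb₂⟩
    · obtain ⟨r, hr0, hr1, hr⟩ := exists_complement_factor h ht₁1
      have hm := erasureSplit_matches hpX hpW ht₂0 ht₂1 hr0 hr1
      refine ⟨_, hm, Or.inr ((hm.mem_RSWSC31B_iff hch1 R).2 ⟨h0, h0', ?_, ?_⟩)⟩ <;>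
      simp only [erasureSplit_firstMI, erasureSplit_secondMI, hr, le_min_iff,
        sub_sub_cancel]
      · exact ⟨ha₁, ha₂⟩
      · exact ⟨hb₂, hb₁⟩
  · rintro ⟨s, hm, h⟩
    rw [hm.mem_RSWSC31A_iff hch1, hm.mem_RSWSC31B_iff hch1] at h
    obtain ⟨⟨l₁, u₁⟩, l₂, u₂⟩ := hm.MI_bounds₁ hch0 hch1
    obtain ⟨⟨l₃, u₃⟩, l₄, u₄⟩ := hm.MI_bounds₂ hch0 hch1
    rw [← hm.2]
    simp only [le_min_iff] at h
    rcases h with ⟨h0, h0', ⟨h₁, h₂⟩, h₃, h₄⟩ | ⟨h0, h0', ⟨h₁, h₂⟩, h₃, h₄⟩ <;>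
    refine ⟨⟨h0, h0', ?_, ?_, ?_⟩, h0, h0', ?_, ?_, ?_⟩ <;> linarith
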